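/- Let V be a normed complex vector space, m ∈ ℝ and ρ ≥ 0, and let F ∈ S^{m,ρ}(ℝ^n, V). Then the map y ↦ τ_y^*F (where τ_y^*F(x) := F(x+y)) is continuous at y = 0 in the S^{m,ρ}-topology: for every multiindex μ ∈ ℕ^n, ‖τ_y^*F − F‖^{m,ρ}_μ → 0 as y → 0. More precisely, for every μ there is a constant c' > 0 such that ‖τ_y^*F − F‖^{m,ρ}_μ ≤ c' ‖y‖ (1+‖y‖²)^{|m−ρ|μ||/2} for all y ∈ ℝ^n. -/

import Mathlib

open Filter MeasureTheory

noncomputable def pder {n : ℕ} {V : Type*} [NormedAddCommGroup V] [NormedSpace ℝ V]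
    (i : Fin n) (f : (Fin n → ℝ) → V) : (Fin n → ℝ) → V :=
  fun x => fderiv ℝ f x (Pi.single i 1)

noncomputable def mder {n : ℕ} {V : Type*} [NormedAddCommGroup V] [NormedSpace ℝ V]
    (μ : Fin n → ℕ) (f : (Fin n → ℝ) → V) : (Fin n → ℝ) → V :=
  (List.finRange n).foldr (fun i g => (pder i)^[μ i] g) f

def mOrder {n : ℕ} (μ : Fin n → ℕ) : ℕ := ∑ i, μ i

noncomputable def symWt {n : ℕ} (m ρ : ℝ) (μ : Fin n → ℕ) (x : Fin n → ℝ) : ℝ :=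
  (1 + ‖x‖ ^ 2) ^ (-(m - ρ * (mOrder μ : ℝ)) / 2)

noncomputable def symNorm {n : ℕ} {V : Type*} [NormedAddCommGroup V] [NormedSpace ℝ V]
    (m ρ : ℝ) (μ : Fin n → ℕ) (F : (Fin n → ℝ) → V) : ℝ :=
  ⨆ x : Fin n → ℝ, symWt m ρ μ x * ‖mder μ F x‖

def IsSymbol {n : ℕ} {V : Type*} [NormedAddCommGroup V] [NormedSpace ℝ V]
    (m ρ : ℝ) (F : (Fin n → ℝ) → V) : Prop :=
  ContDiff ℝ (⊤ : ℕ∞) F ∧ ∀ μ : Fin n → ℕ, ∃ C : ℝ, ∀ x, symWt m ρ μ x * ‖mder μ F x‖ ≤ C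

section PartialDerivatives

variable {n : ℕ} {V : Type*} [NormedAddCommGroup V] [NormedSpace ℝ V]
  {f : (Fin n → ℝ) → V}

lemma contDiff_pder (i : Fin n) (hf : ContDiff ℝ (⊤ : ℕ∞) f) :
    ContDiff ℝ (⊤ : ℕ∞) (pder i f) :=
  (hf.fderiv_right (m := (⊤ : ℕ∞)) (by simp)).clm_apply contDiff_const

lemma contDiff_pder_iterate (i : Fin n) (k : ℕ) (hf : ContDiff ℝ (⊤ : ℕ∞) f) :
    ContDiff ℝ (⊤ : ℕ∞) ((pder i)^[k] f) := by
  induction k with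
  | zero => exact hf
  | succ k ih => rw [Function.iterate_succ_apply']; exact contDiff_pder i ih

lemma contDiff_foldr_pder (l : List (Fin n)) (μ : Fin n → ℕ) (hf : ContDiff ℝ (⊤ : ℕ∞) f) :
    ContDiff ℝ (⊤ : ℕ∞) (l.foldr (fun i g => (pder i)^[μ i] g) f) := by
  induction l with
  | nil => exact hf
  | cons a l ih => exact contDiff_pder_iterate a _ ih

lemma contDiff_mder (μ : Fin n → ℕ) (hf : ContDiff ℝ (⊤ : ℕ∞) f) :
    ContDiff ℝ (⊤ : ℕ∞) (mder μ f) :=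
  contDiff_foldr_pder _ μ hf

lemma pder_comm (i j : Fin n) (hf : ContDiff ℝ (⊤ : ℕ∞) f) :
    pder i (pder j f) = pder j (pder i f) := by
  have hd : Differentiable ℝ (fderiv ℝ f) :=
    (hf.fderiv_right (m := (⊤ : ℕ∞)) (by simp)).differentiable (by simp)
  have key (a b : Fin n) (x : Fin n → ℝ) :
      pder a (pder b f) x = fderiv ℝ (fderiv ℝ f) x (Pi.single a 1) (Pi.single b 1) := by
    change fderiv ℝ (fun z => fderiv ℝ f z (Pi.single b 1)) x (Pi.single a 1) = _
    rw [fderiv_clm_apply (hd x) (differentiableAt_const _)]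
    simp
  ext x
  rw [key, key]
  exact (hf.contDiffAt.isSymmSndFDerivAt (by
    simpa using WithTop.coe_le_coe.2 (le_top : (2 : ℕ∞) ≤ ⊤))).eq _ _

lemma pder_iterate_comm (i j : Fin n) (k : ℕ) (hf : ContDiff ℝ (⊤ : ℕ∞) f) :
    (pder j)^[k] (pder i f) = pder i ((pder j)^[k] f) := by
  induction k with
  | zero => rfl
  | succ k ih =>
    rw [Function.iterate_succ_apply', ih, Function.iterate_succ_apply',
      pder_comm j i (contDiff_pder_iterate j k hf)]

lemma foldr_pder_congr {l : List (Fin n)} {μ ν : Fin n → ℕ} (h : ∀ i ∈ l, μ i = ν i) :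
    l.foldr (fun i g => (pder i)^[μ i] g) f = l.foldr (fun i g => (pder i)^[ν i] g) f := by
  induction l with
  | nil => rfl
  | cons a l ih =>
    rw [List.foldr_cons, List.foldr_cons, ih fun i hi => h i (List.mem_cons_of_mem a hi),
      h a List.mem_cons_self]

lemma foldr_pder_add_single {l : List (Fin n)} (hl : l.Nodup) (μ : Fin n → ℕ) {i : Fin n}
    (hi : i ∈ l) (hf : ContDiff ℝ (⊤ : ℕ∞) f) :
    l.foldr (fun j g => (pder j)^[(μ + Pi.single i 1 : Fin n → ℕ) j] g) f =
      pder i (l.foldr (fun j g => (pder j)^[μ j] g) f) := by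
  induction l with
  | nil => simp at hi
  | cons a l ih =>
    rw [List.nodup_cons] at hl
    rw [List.foldr_cons, List.foldr_cons]
    by_cases h : i = a
    · subst h
      have hcongr : ∀ j ∈ l, (μ + Pi.single i 1 : Fin n → ℕ) j = μ j := fun j hj => by
        have : j ≠ i := fun e => hl.1 (e ▸ hj)
        simp [this]
      rw [foldr_pder_congr hcongr, Pi.add_apply, Pi.single_eq_same,
        Function.iterate_succ_apply']
    · rw [ih hl.2 ((List.mem_cons.1 hi).resolve_left h),
        pder_iterate_comm i a _ (contDiff_foldr_pder l μ hf)]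
      simp [Ne.symm h]

lemma mder_add_single (μ : Fin n → ℕ) (i : Fin n) (hf : ContDiff ℝ (⊤ : ℕ∞) f) :
    mder (μ + Pi.single i 1) f = pder i (mder μ f) :=
  foldr_pder_add_single (List.nodup_finRange n) μ (List.mem_finRange i) hf

lemma mOrder_add_single (μ : Fin n → ℕ) (i : Fin n) :
    mOrder (μ + Pi.single i 1) = mOrder μ + 1 := by
  simp [mOrder, Finset.sum_add_distrib]

lemma pder_translate_sub (i : Fin n) (y : Fin n → ℝ) (hf : ContDiff ℝ (⊤ : ℕ∞) f) :
    pder i (fun x => f (x + y) - f x) = fun x => pder i f (x + y) - pder i f x := by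
  have hd : Differentiable ℝ f := hf.differentiable (by simp)
  ext x
  simp only [pder]
  have hd' : DifferentiableAt ℝ (fun z => f (z + y)) x :=
    (hd _).comp x (differentiableAt_id.add_const y)
  rw [fderiv_fun_sub hd' (hd x),
    fderiv_comp_add_right]
  rfl

lemma pder_iterate_translate_sub (i : Fin n) (k : ℕ) (y : Fin n → ℝ)
    (hf : ContDiff ℝ (⊤ : ℕ∞) f) :
    (pder i)^[k] (fun x => f (x + y) - f x) =
      fun x => (pder i)^[k] f (x + y) - (pder i)^[k] f x := by
  induction k with
  | zero => rfl
  | succ k ih =>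
    simp only [Function.iterate_succ_apply']
    rw [ih, pder_translate_sub i y (contDiff_pder_iterate i k hf)]

lemma mder_translate_sub (μ : Fin n → ℕ) (y : Fin n → ℝ) (hf : ContDiff ℝ (⊤ : ℕ∞) f) :
    mder μ (fun x => f (x + y) - f x) = fun x => mder μ f (x + y) - mder μ f x := by
  unfold mder
  induction List.finRange n with
  | nil => rfl
  | cons a l ih =>
    simp only [List.foldr_cons]
    rw [ih, pder_iterate_translate_sub a _ y (contDiff_foldr_pder l μ hf)]

lemma norm_fderiv_le_sum_pder (f : (Fin n → ℝ) → V) (x : Fin n → ℝ) :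
    ‖fderiv ℝ f x‖ ≤ ∑ i, ‖pder i f x‖ := by
  refine ContinuousLinearMap.opNorm_le_bound _ (by positivity) fun v => ?_
  have hv : fderiv ℝ f x v = ∑ i, v i • pder i f x := by
    conv_lhs => rw [pi_eq_sum_univ' v]
    simp only [map_sum, map_smul]
    rfl
  rw [hv, Finset.sum_mul]
  refine (norm_sum_le _ _).trans (Finset.sum_le_sum fun i _ => ?_)
  rw [norm_smul, mul_comm]
  gcongr
  exact norm_le_pi_norm v i

end PartialDerivatives

section Weights

lemma one_add_norm_add_sq_le {E : Type*} [SeminormedAddCommGroup E] (x w : E) :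
    1 + ‖x + w‖ ^ 2 ≤ 2 * (1 + ‖w‖ ^ 2) * (1 + ‖x‖ ^ 2) := by
  have h : ‖x + w‖ ^ 2 ≤ (‖x‖ + ‖w‖) ^ 2 := by gcongr; exact norm_add_le x w
  nlinarith [sq_nonneg (‖x‖ - ‖w‖), mul_nonneg (sq_nonneg ‖x‖) (sq_nonneg ‖w‖)]

lemma rpow_neg_mul_rpow_le {a b K : ℝ} (ha : 0 < a) (hb : 0 < b) (hK : 0 ≤ K)
    (hab : a ≤ K * b) (hba : b ≤ K * a) (q : ℝ) : b ^ (-q) * a ^ q ≤ K ^ |q| := by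
  rcases le_total 0 q with hq | hq
  · rw [abs_of_nonneg hq, Real.rpow_neg hb.le, inv_mul_le_iff₀ (by positivity), mul_comm,
      ← Real.mul_rpow hK hb.le]
    exact Real.rpow_le_rpow ha.le hab hq
  · have hq' : 0 ≤ -q := by linarith
    rw [abs_of_nonpos hq, ← neg_neg q, Real.rpow_neg ha.le, neg_neg, mul_inv_le_iff₀ (by positivity),
      ← Real.mul_rpow hK ha.le]
    exact Real.rpow_le_rpow hb.le hba hq'

/-- Peetre's inequality. -/
lemma one_add_norm_sq_rpow_peetre {E : Type*} [SeminormedAddCommGroup E] (x w : E) (q : ℝ) :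
    (1 + ‖x‖ ^ 2) ^ (-q) * (1 + ‖x + w‖ ^ 2) ^ q ≤ 2 ^ |q| * (1 + ‖w‖ ^ 2) ^ |q| := by
  rw [← Real.mul_rpow (by norm_num) (by positivity)]
  refine rpow_neg_mul_rpow_le (by positivity) (by positivity) (by positivity)
    (one_add_norm_add_sq_le x w) ?_ q
  simpa using one_add_norm_add_sq_le (x + w) (-w)

end Weights

section Symbols

variable {n : ℕ} {V : Type*} [NormedAddCommGroup V] [NormedSpace ℝ V] {m ρ : ℝ}
  {F : (Fin n → ℝ) → V}

lemma symNorm_nonneg (m ρ : ℝ) (μ : Fin n → ℕ) (F : (Fin n → ℝ) → V) :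
    0 ≤ symNorm m ρ μ F :=
  Real.iSup_nonneg fun x => by unfold symWt; positivity

lemma IsSymbol.exists_norm_fderiv_mder_le (hρ : 0 ≤ ρ) (hF : IsSymbol m ρ F) (μ : Fin n → ℕ) :
    ∃ C : ℝ, 0 ≤ C ∧ ∀ x,
      ‖fderiv ℝ (mder μ F) x‖ ≤ C * (1 + ‖x‖ ^ 2) ^ ((m - ρ * (mOrder μ : ℝ)) / 2) := by
  choose C hC using fun i => hF.2 (μ + Pi.single i 1)
  refine ⟨∑ i, |C i|, by positivity, fun x => ?_⟩
  refine (norm_fderiv_le_sum_pder _ x).trans ?_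
  rw [Finset.sum_mul]
  refine Finset.sum_le_sum fun i _ => ?_
  have hb : 1 ≤ 1 + ‖x‖ ^ 2 := by nlinarith [sq_nonneg ‖x‖]
  have h := (hC i x).trans (le_abs_self _)
  rw [mder_add_single μ i hF.1, symWt, neg_div, Real.rpow_neg (by positivity),
    inv_mul_le_iff₀ (by positivity), mul_comm] at h
  refine h.trans (mul_le_mul_of_nonneg_left ?_ (abs_nonneg _))
  refine Real.rpow_le_rpow_of_exponent_le hb ?_
  rw [mOrder_add_single]
  push_cast
  linarith

lemma IsSymbol.exists_symNorm_translate_sub_le (hρ : 0 ≤ ρ) (hF : IsSymbol m ρ F)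
    (μ : Fin n → ℕ) : ∃ c : ℝ, 0 < c ∧ ∀ y : Fin n → ℝ,
      symNorm m ρ μ (fun x => F (x + y) - F x) ≤
        c * ‖y‖ * (1 + ‖y‖ ^ 2) ^ (|m - ρ * (mOrder μ : ℝ)| / 2) := by
  obtain ⟨C, hC0, hC⟩ := hF.exists_norm_fderiv_mder_le hρ μ
  set q : ℝ := (m - ρ * (mOrder μ : ℝ)) / 2 with hq
  have hqabs : |m - ρ * (mOrder μ : ℝ)| / 2 = |q| := by rw [hq, abs_div, abs_two]
  refine ⟨(C + 1) * 2 ^ |q|, by positivity, fun y => ciSup_le fun x => ?_⟩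
  rw [mder_translate_sub μ y hF.1, hqabs, symWt, neg_div, ← hq]
  have hd : Differentiable ℝ (mder μ F) := (contDiff_mder μ hF.1).differentiable (by simp)
  have hbound : ∀ z ∈ segment ℝ x (x + y), ‖fderiv ℝ (mder μ F) z‖ ≤
      C * ((1 + ‖x‖ ^ 2) ^ q * (2 ^ |q| * (1 + ‖y‖ ^ 2) ^ |q|)) := by
    intro z hz
    rw [segment_eq_image'] at hz
    obtain ⟨t, ⟨ht0, ht1⟩, rfl⟩ := hz
    refine (hC _).trans (mul_le_mul_of_nonneg_left ?_ hC0)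
    have hp := one_add_norm_sq_rpow_peetre x (t • (x + y - x)) q
    rw [Real.rpow_neg (by positivity), inv_mul_le_iff₀ (by positivity)] at hp
    refine hp.trans ?_
    gcongr
    rw [add_sub_cancel_left, norm_smul, Real.norm_of_nonneg ht0]
    exact mul_le_of_le_one_left (norm_nonneg y) ht1
  have hmv := (convex_segment x (x + y)).norm_image_sub_le_of_norm_fderiv_le
    (fun z _ => hd z) hbound (left_mem_segment ℝ x (x + y)) (right_mem_segment ℝ x (x + y))
  rw [add_sub_cancel_left] at hmv
  rw [Real.rpow_neg (by positivity), inv_mul_le_iff₀ (by positivity)]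
  calc _ ≤ C * ((1 + ‖x‖ ^ 2) ^ q * (2 ^ |q| * (1 + ‖y‖ ^ 2) ^ |q|)) * ‖y‖ := hmv
    _ ≤ (C + 1) * ((1 + ‖x‖ ^ 2) ^ q * (2 ^ |q| * (1 + ‖y‖ ^ 2) ^ |q|)) * ‖y‖ := by
      gcongr; linarith
    _ = _ := by ring

end Symbols

theorem statement8 {n : ℕ} {V : Type*} [NormedAddCommGroup V] [NormedSpace ℝ V]
    [NormedSpace ℂ V] [IsScalarTower ℝ ℂ V]
    (m ρ : ℝ) (hρ : 0 ≤ ρ) (F : (Fin n → ℝ) → V) (hF : IsSymbol m ρ F) :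
    (∀ μ : Fin n → ℕ,
      Tendsto (fun y : Fin n → ℝ => symNorm m ρ μ (fun x => F (x + y) - F x))
        (nhds 0) (nhds 0)) ∧
    (∀ μ : Fin n → ℕ, ∃ c' : ℝ, 0 < c' ∧ ∀ y : Fin n → ℝ,
      symNorm m ρ μ (fun x => F (x + y) - F x) ≤
        c' * ‖y‖ * (1 + ‖y‖ ^ 2) ^ (|m - ρ * (mOrder μ : ℝ)| / 2)) := by
  have h := hF.exists_symNorm_translate_sub_le hρ
  refine ⟨fun μ => ?_, h⟩
  obtain ⟨c, -, hc⟩ := h μ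
  refine squeeze_zero (fun y => symNorm_nonneg m ρ μ _) hc ?_
  have hcont : Continuous fun y : Fin n → ℝ =>
      c * ‖y‖ * (1 + ‖y‖ ^ 2) ^ (|m - ρ * (mOrder μ : ℝ)| / 2) :=
    (continuous_const.mul continuous_norm).mul
      ((continuous_const.add (continuous_norm.pow 2)).rpow_const
        fun y => Or.inl (by change 1 + ‖y‖ ^ 2 ≠ 0; positivity))
  simpa using hcont.tendsto 0
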